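/- Let f : ℝ → ℝ be infinitely differentiable and let a > 0. Suppose there exists a constant M > 0 such that |f^{(n+1)}(t)| ≤ M·|f^{(n)}(t)| for every natural number n and every t ∈ [-a, a]. Then the series \hat{f}(t) converges uniformly on (-a, a) to the constant f(0); in particular \hat{f}(t) = f(0) for all t ∈ (-a, a). -/

import Mathlib

open Filter Finset

/-- The derivative of the partial sums of `∑ ((-1)^n/n!) t^n f^{(n)}(t)` telescopes. -/
theorem hasDerivAt_sum_pow_mul_iteratedDeriv {f : ℝ → ℝ} (hf : ContDiff ℝ (⊤ : ℕ∞) f)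
    (N : ℕ) (t : ℝ) :
    HasDerivAt (fun t : ℝ => ∑ n ∈ Finset.range (N + 1),
        ((-1 : ℝ) ^ n / (n.factorial : ℝ)) * t ^ n * iteratedDeriv n f t)
      (((-1 : ℝ) ^ N / (N.factorial : ℝ)) * t ^ N * iteratedDeriv (N + 1) f t) t := by
  have hderiv : ∀ n : ℕ, HasDerivAt (iteratedDeriv n f) (iteratedDeriv (n + 1) f t) t := by
    intro n
    rw [iteratedDeriv_succ]
    exact (hf.differentiable_iteratedDeriv n (by exact_mod_cast WithTop.coe_lt_top n) t).hasDerivAt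
  induction N with
  | zero => simpa using hderiv 0
  | succ N ih =>
    simp_rw [Finset.sum_range_succ _ (N + 1)]
    have hterm := ((hasDerivAt_pow (N + 1) t).const_mul
      ((-1 : ℝ) ^ (N + 1) / ((N + 1).factorial : ℝ))).mul (hderiv (N + 1))
    refine (ih.add hterm).congr_deriv ?_
    have hfac : (N.factorial : ℝ) ≠ 0 := by positivity
    have hsucc : (N : ℝ) + 1 ≠ 0 := by positivity
    rw [Nat.factorial_succ]
    push_cast
    field_simp
    ring

/-- Iterating `|u (n + 1)| ≤ M |u n|` gives geometric growth. -/
theorem abs_le_pow_mul_abs_of_abs_succ_le {u : ℕ → ℝ} {M : ℝ} (hM : 0 ≤ M)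
    (h : ∀ n, |u (n + 1)| ≤ M * |u n|) (n : ℕ) : |u n| ≤ M ^ n * |u 0| := by
  induction n with
  | zero => simp
  | succ n ih =>
    calc |u (n + 1)| ≤ M * |u n| := h n
      _ ≤ M * (M ^ n * |u 0|) := by gcongr
      _ = M ^ (n + 1) * |u 0| := by ring

/-- If there is a constant `M > 0` with `|f^{(n+1)}(t)| ≤ M |f^{(n)}(t)|` for all `n` and
all `t ∈ [-a, a]`, then the series `∑_{n=0}^∞ ((-1)^n/n!) t^n f^{(n)}(t)` converges
uniformly on `(-a, a)` to the constant `f(0)`; in particular it converges pointwise to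
`f(0)` there. -/
theorem stmt4 (f : ℝ → ℝ) (hf : ContDiff ℝ (⊤ : ℕ∞) f) (a : ℝ) (ha : 0 < a)
    (M : ℝ) (hM : 0 < M)
    (hbound : ∀ n : ℕ, ∀ t ∈ Set.Icc (-a) a,
      |iteratedDeriv (n + 1) f t| ≤ M * |iteratedDeriv n f t|) :
    TendstoUniformlyOn
      (fun (N : ℕ) (t : ℝ) => ∑ n ∈ Finset.range N,
        ((-1 : ℝ) ^ n / (n.factorial : ℝ)) * t ^ n * iteratedDeriv n f t)
      (fun _ => f 0) atTop (Set.Ioo (-a) a) ∧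
    ∀ t ∈ Set.Ioo (-a) a,
      Filter.Tendsto
        (fun N : ℕ => ∑ n ∈ Finset.range N,
          ((-1 : ℝ) ^ n / (n.factorial : ℝ)) * t ^ n * iteratedDeriv n f t)
        atTop (nhds (f 0)) := by
  obtain ⟨C, hC⟩ := isCompact_Icc.exists_bound_of_continuousOn
    (hf.continuous.continuousOn (s := Set.Icc (-a) a))
  have hbd : ∀ N : ℕ, ∀ t ∈ Set.Icc (-a) a,
      |∑ n ∈ Finset.range (N + 1),
        ((-1 : ℝ) ^ n / (n.factorial : ℝ)) * t ^ n * iteratedDeriv n f t - f 0|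
      ≤ (a * M) ^ N / (N.factorial : ℝ) * (M * C * a) := by
    intro N t ht
    have h0 : (0 : ℝ) ∈ Set.Icc (-a) a := ⟨by linarith, ha.le⟩
    have hC0 : 0 ≤ C := (norm_nonneg _).trans (hC 0 h0)
    have hmvt := (convex_Icc (-a) a).norm_image_sub_le_of_norm_hasDerivWithin_le
      (C := (a * M) ^ N / (N.factorial : ℝ) * (M * C))
      (fun x _ => (hasDerivAt_sum_pow_mul_iteratedDeriv hf N x).hasDerivWithinAt)
      (fun x hx => by
        have hxa : |x| ≤ a := abs_le.mpr hx
        have hfx : |f x| ≤ C := hC x hx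
        have hx' : |iteratedDeriv (N + 1) f x| ≤ M ^ (N + 1) * |f x| := by
          simpa using abs_le_pow_mul_abs_of_abs_succ_le (u := fun n => iteratedDeriv n f x)
            hM.le (fun n => hbound n x hx) (N + 1)
        rw [Real.norm_eq_abs, abs_mul, abs_mul, abs_div, abs_pow, abs_pow, abs_neg, abs_one,
          one_pow, Nat.abs_cast]
        calc 1 / (N.factorial : ℝ) * |x| ^ N * |iteratedDeriv (N + 1) f x|
            ≤ 1 / (N.factorial : ℝ) * a ^ N * (M ^ (N + 1) * C) := by
              gcongr
              exact hx'.trans (by gcongr)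
          _ = (a * M) ^ N / (N.factorial : ℝ) * (M * C) := by
              rw [mul_pow]
              ring)
      h0 ht
    have hzero : ∑ n ∈ Finset.range (N + 1),
        ((-1 : ℝ) ^ n / (n.factorial : ℝ)) * 0 ^ n * iteratedDeriv n f 0 = f 0 := by
      simp [Finset.sum_range_succ']
    rw [hzero, Real.norm_eq_abs, sub_zero, Real.norm_eq_abs] at hmvt
    have hta : |t| ≤ a := abs_le.mpr ht
    calc _ ≤ (a * M) ^ N / (N.factorial : ℝ) * (M * C) * |t| := hmvt
      _ ≤ (a * M) ^ N / (N.factorial : ℝ) * (M * C) * a := by gcongr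
      _ = _ := by ring
  have hlim : Tendsto (fun N : ℕ => (a * M) ^ N / (N.factorial : ℝ) * (M * C * a))
      atTop (nhds 0) := by
    simpa using (FloorSemiring.tendsto_pow_div_factorial_atTop (a * M)).mul_const (M * C * a)
  have hunif : TendstoUniformlyOn
      (fun (N : ℕ) (t : ℝ) => ∑ n ∈ Finset.range N,
        ((-1 : ℝ) ^ n / (n.factorial : ℝ)) * t ^ n * iteratedDeriv n f t)
      (fun _ => f 0) atTop (Set.Ioo (-a) a) := by
    rw [Metric.tendstoUniformlyOn_iff]
    intro ε hε
    obtain ⟨N₀, hN₀⟩ := eventually_atTop.mp (hlim.eventually_lt_const hε)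
    refine eventually_atTop.mpr ⟨N₀ + 1, fun N hN t ht => ?_⟩
    obtain ⟨K, rfl⟩ : ∃ K, N = K + 1 := ⟨N - 1, by omega⟩
    rw [dist_comm, Real.dist_eq]
    exact (hbd K t (Set.Ioo_subset_Icc_self ht)).trans_lt (hN₀ K (by omega))
  exact ⟨hunif, fun t ht => hunif.tendsto_at ht⟩
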